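/- Let Y be a set of labels, d a positive integer, σ > 0, and let h : ℝ^d → Y be a function whose label preimages are measurable. Let γ_σ be the product measure on ℝ^d of d copies of the one-dimensional Gaussian distribution N(0, σ²), and for w ∈ ℝ^d and y ∈ Y define q^y(w) = γ_σ({ε ∈ ℝ^d : h(w + ε) = y}). Suppose y_A ∈ Y and real numbers p_A, p_B ∈ (0,1) with p_A ≥ p_B satisfy q^{y_A}(w) ≥ p_A and q^y(w) ≤ p_B for every y ≠ y_A, and let a, b ∈ ℝ satisfy Φ(a) = p_A and Φ(b) = p_B, where Φ is the cumulative distribution function of the standard Gaussian N(0,1). Then for every δ ∈ ℝ^d with ‖δ‖₂ < (σ/2)·(a − b) and every y ≠ y_A, it holds that q^{y_A}(w + δ) ≥ q^y(w + δ). -/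

import Mathlib

open MeasureTheory ProbabilityTheory
open scoped BigOperators

open scoped ENNReal NNReal

/-- The easy half of the Neyman–Pearson lemma: a sublevel set of a density minimizes the measure
with that density among all sets that are at least as large for the reference measure. -/
theorem withDensity_le_withDensity_of_threshold {α : Type*} [MeasurableSpace α] (μ : Measure α)
    [IsFiniteMeasure μ] {f : α → ℝ≥0∞} {t : ℝ≥0∞} {S A : Set α}
    (hS : MeasurableSet S) (hA : MeasurableSet A) (hle : ∀ x ∈ S, f x ≤ t)
    (hge : ∀ x ∉ S, t ≤ f x) (hSA : μ S ≤ μ A) :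
    μ.withDensity f S ≤ μ.withDensity f A := by
  have hdiff : μ (S \ A) ≤ μ (A \ S) := by
    rw [← measure_inter_add_sdiff S hA, ← measure_inter_add_sdiff A hS, Set.inter_comm A S] at hSA
    exact (ENNReal.add_le_add_iff_left (measure_ne_top μ _)).1 hSA
  rw [← measure_inter_add_sdiff S hA, ← measure_inter_add_sdiff A hS, Set.inter_comm A S]
  gcongr 1
  rw [withDensity_apply _ (hS.diff hA), withDensity_apply _ (hA.diff hS)]
  calc ∫⁻ x in S \ A, f x ∂μ ≤ ∫⁻ _ in S \ A, t ∂μ :=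
        setLIntegral_mono' (hS.diff hA) fun x hx => hle x hx.1
    _ = t * μ (S \ A) := setLIntegral_const _ _
    _ ≤ t * μ (A \ S) := by gcongr
    _ = ∫⁻ _ in A \ S, t ∂μ := (setLIntegral_const _ _).symm
    _ ≤ ∫⁻ x in A \ S, f x ∂μ := setLIntegral_mono' (hA.diff hS) fun x hx => hge x hx.2

theorem pi_withDensity {ι : Type*} [Fintype ι] {α : ι → Type*} [∀ i, MeasurableSpace (α i)]
    (μ : ∀ i, Measure (α i)) [∀ i, IsProbabilityMeasure (μ i)] {f : ∀ i, α i → ℝ≥0∞}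
    (hf : ∀ i, Measurable (f i)) [∀ i, SigmaFinite ((μ i).withDensity (f i))] :
    Measure.pi (fun i => (μ i).withDensity (f i)) =
      (Measure.pi μ).withDensity fun x => ∏ i, f i (x i) := by
  classical
  refine Measure.pi_eq fun s hs => ?_
  have hmeas (i : ι) : Measurable ((s i).indicator (f i)) := (hf i).indicator (hs i)
  have hbox (x : ∀ i, α i) : (Set.univ.pi s).indicator (fun x => ∏ i, f i (x i)) x =
      ∏ i, (s i).indicator (f i) (x i) := by
    by_cases hx : x ∈ Set.univ.pi s
    · rw [Set.indicator_of_mem hx]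
      exact Finset.prod_congr rfl fun i _ => (Set.indicator_of_mem (hx i trivial) _).symm
    · rw [Set.indicator_of_notMem hx]
      simp only [Set.mem_univ_pi, not_forall] at hx
      obtain ⟨i, hi⟩ := hx
      exact (Finset.prod_eq_zero (Finset.mem_univ i) (Set.indicator_of_notMem hi _)).symm
  have hbm : MeasurableSet (Set.univ.pi s) := MeasurableSet.univ_pi hs
  rw [withDensity_apply _ hbm, ← lintegral_indicator hbm, lintegral_congr hbox,
    lintegral_prod_eq_prod_lintegral_of_indepFun Finset.univ
      (fun i (x : ∀ i, α i) => (s i).indicator (f i) (x i))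
      (iIndepFun_pi fun i => (hmeas i).aemeasurable)
      (fun i => (hmeas i).comp (measurable_pi_apply i))]
  refine Finset.prod_congr rfl fun i _ => ?_
  rw [withDensity_apply _ (hs i), ← lintegral_indicator (hs i),
    ← (measurePreserving_eval μ i).lintegral_comp (hmeas i)]

theorem gaussianReal_eq_withDensity_gaussianReal_zero (m : ℝ) {v : ℝ≥0} (hv : v ≠ 0) :
    gaussianReal m v = (gaussianReal 0 v).withDensity
      fun x => ENNReal.ofReal (Real.exp ((m * x - m ^ 2 / 2) / v)) := by
  rw [gaussianReal_of_var_ne_zero m hv, gaussianReal_of_var_ne_zero 0 hv,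
    ← withDensity_mul _ (by fun_prop) (by fun_prop)]
  congr 1
  ext x
  have hv' : (v : ℝ) ≠ 0 := by exact_mod_cast hv
  rw [Pi.mul_apply, gaussianPDF, gaussianPDF, ← ENNReal.ofReal_mul (gaussianPDFReal_nonneg _ _ _),
    gaussianPDFReal, gaussianPDFReal, mul_assoc _ (Real.exp _), ← Real.exp_add]
  congr 3
  field_simp
  ring

theorem map_const_add_pi_gaussianReal {ι : Type*} [Fintype ι] {v : ℝ≥0} (hv : v ≠ 0)
    (δ : ι → ℝ) :
    (Measure.pi fun _ : ι => gaussianReal 0 v).map (δ + ·) =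
      (Measure.pi fun _ : ι => gaussianReal 0 v).withDensity fun x =>
        ENNReal.ofReal (Real.exp ((∑ i, δ i * x i - (∑ i, δ i ^ 2) / 2) / v)) := by
  have hmap : (Measure.pi fun _ : ι => gaussianReal 0 v).map (δ + ·) =
      Measure.pi fun i => gaussianReal (δ i) v := by
    have := Measure.pi_map_pi (μ := fun _ : ι => gaussianReal 0 v) (f := fun i x => δ i + x)
      (fun i => by fun_prop)
    simp_rw [gaussianReal_map_const_add, zero_add] at this
    exact this
  have hdens (i : ι) := gaussianReal_eq_withDensity_gaussianReal_zero (δ i) hv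
  have (i : ι) : SigmaFinite ((gaussianReal 0 v).withDensity
      fun x => ENNReal.ofReal (Real.exp ((δ i * x - δ i ^ 2 / 2) / v))) := by
    rw [← hdens i]; infer_instance
  simp_rw [hmap, hdens]
  rw [pi_withDensity _ fun i => by fun_prop]
  congr 1
  ext x
  rw [← ENNReal.ofReal_prod_of_nonneg fun i _ => (Real.exp_pos _).le, ← Real.exp_sum,
    ← Finset.sum_div, Finset.sum_sub_distrib, Finset.sum_div]

theorem map_sum_mul_pi_gaussianReal {ι : Type*} [Fintype ι] (v : ℝ≥0) (c : ι → ℝ) :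
    (Measure.pi fun _ : ι => gaussianReal 0 v).map (fun x => ∑ i, c i * x i) =
      gaussianReal 0 (v * (∑ i, c i ^ 2).toNNReal) := by
  have hmeas : Measurable fun x : ι → ℝ => ∑ i, c i * x i := by fun_prop
  have := Measure.isProbabilityMeasure_map (μ := Measure.pi fun _ : ι => gaussianReal 0 v)
    hmeas.aemeasurable
  refine Measure.ext_of_charFun (funext fun t => ?_)
  have hpi := charFun_pi (μ := fun _ : ι => gaussianReal 0 v) (WithLp.toLp 2 fun i => t * c i)
  rw [charFun_apply, integral_map (by fun_prop) (by fun_prop)] at hpi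
  rw [charFun_apply, integral_map hmeas.aemeasurable (by fun_prop)]
  simp only [charFun_gaussianReal] at hpi ⊢
  convert hpi using 1
  · refine integral_congr_ae (Filter.Eventually.of_forall fun x => ?_)
    simp [PiLp.inner_apply, Finset.mul_sum, mul_assoc]
  · rw [← Complex.exp_sum]
    congr 1
    have hsum : 0 ≤ ∑ i, c i ^ 2 := Finset.sum_nonneg fun i _ => sq_nonneg (c i)
    simp only [NNReal.coe_mul, Real.coe_toNNReal _ hsum]
    push_cast
    simp only [mul_zero, zero_mul, zero_sub, mul_pow, Finset.sum_neg_distrib, Finset.mul_sum,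
      Finset.sum_mul, Finset.sum_div]
    exact congrArg _ (Finset.sum_congr rfl fun i _ => by ring)

theorem gaussianReal_Iic_neg (b : ℝ) :
    gaussianReal 0 1 (Set.Iic (-b)) = 1 - gaussianReal 0 1 (Set.Iic b) := by
  have hnull : NullSingletonClass (gaussianReal 0 1) := nullSingletonClass_gaussianReal one_ne_zero
  have hneg : gaussianReal 0 1 (Set.Iic (-b)) = gaussianReal 0 1 (Set.Ici b) := by
    conv_lhs => rw [← neg_zero, ← gaussianReal_map_neg,
      Measure.map_apply measurable_neg measurableSet_Iic]
    congr 1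
    ext x
    simp
  rw [hneg, ← Ioi_ae_eq_Ici.measure_eq, ← Set.compl_Iic, prob_compl_eq_one_sub measurableSet_Iic]

/-- Translating a set of Gaussian measure at least `Φ a` by `δ` leaves it with Gaussian measure at
least `Φ (a - ‖δ‖₂ / σ)`. -/
theorem gaussianReal_Iic_sub_le_pi_preimage_add {ι : Type*} [Fintype ι] {σ : ℝ} (hσ : 0 < σ)
    {v : ℝ≥0} (hvσ : (v : ℝ) = σ ^ 2)
    (δ : ι → ℝ) {E : Set (ι → ℝ)} (hE : MeasurableSet E) {a : ℝ}
    (ha : gaussianReal 0 1 (Set.Iic a) ≤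
      Measure.pi (fun _ : ι => gaussianReal 0 v) E) :
    gaussianReal 0 1 (Set.Iic (a - Real.sqrt (∑ i, δ i ^ 2) / σ)) ≤
      Measure.pi (fun _ : ι => gaussianReal 0 v) ((δ + ·) ⁻¹' E) := by
  have hv : v ≠ 0 := by
    rw [← NNReal.coe_ne_zero, hvσ]
    positivity
  set γ := Measure.pi fun _ : ι => gaussianReal 0 v
  set r := Real.sqrt (∑ i, δ i ^ 2)
  have hsum : 0 ≤ ∑ i, δ i ^ 2 := Finset.sum_nonneg fun i _ => sq_nonneg (δ i)
  have hr2 : r ^ 2 = ∑ i, δ i ^ 2 := Real.sq_sqrt hsum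
  rcases (show 0 ≤ r from Real.sqrt_nonneg _).eq_or_lt with h0 | hpos
  · have hδ : δ = 0 := by
      rw [← h0, zero_pow two_ne_zero, eq_comm,
        Finset.sum_eq_zero_iff_of_nonneg fun i _ => sq_nonneg (δ i)] at hr2
      ext i
      simpa using hr2 i (Finset.mem_univ i)
    simpa [← h0, hδ] using ha
  have hlaw : γ.map (fun x => ∑ i, δ i / (σ * r) * x i) = gaussianReal 0 1 := by
    rw [map_sum_mul_pi_gaussianReal]
    congr 1
    simp only [div_pow]
    rw [← Finset.sum_div, ← hr2]
    ext
    rw [NNReal.coe_mul, Real.coe_toNNReal _ (by positivity), hvσ, NNReal.coe_one]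
    field_simp
  have hcoef (x : ι → ℝ) : ∑ i, δ i / (σ * r) * x i = (∑ i, δ i * x i) / (σ * r) := by
    rw [Finset.sum_div]
    exact Finset.sum_congr rfl fun i _ => by ring
  have hmeas : Measurable fun x : ι → ℝ => ∑ i, δ i / (σ * r) * x i := by fun_prop
  set S : Set (ι → ℝ) := (fun x => ∑ i, δ i / (σ * r) * x i) ⁻¹' Set.Iic a with hSdef
  have hS : MeasurableSet S := hmeas measurableSet_Iic
  have hmem (x : ι → ℝ) : x ∈ S ↔ ∑ i, δ i * x i ≤ a * (σ * r) := by
    rw [hSdef, Set.mem_preimage, Set.mem_Iic, hcoef, div_le_iff₀ (by positivity)]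
  have hshift : (δ + ·) ⁻¹' S =
      (fun x => ∑ i, δ i / (σ * r) * x i) ⁻¹' Set.Iic (a - r / σ) := by
    ext x
    rw [Set.mem_preimage, hmem, Set.mem_preimage, Set.mem_Iic, hcoef, div_le_iff₀ (by positivity)]
    have h1 : ∑ i, δ i * (δ + x) i = r ^ 2 + ∑ i, δ i * x i := by
      rw [hr2, ← Finset.sum_add_distrib]
      exact Finset.sum_congr rfl fun i _ => by rw [Pi.add_apply]; ring
    have h2 : (a - r / σ) * (σ * r) = a * (σ * r) - r ^ 2 := by field_simp
    rw [h1, h2]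
    constructor <;> intro h <;> linarith
  have hadd : Measurable (δ + · : (ι → ℝ) → ι → ℝ) := measurable_const_add δ
  rw [← hlaw, Measure.map_apply hmeas measurableSet_Iic, ← hshift, ← Measure.map_apply hadd hS,
    ← Measure.map_apply hadd hE, map_const_add_pi_gaussianReal hv]
  refine withDensity_le_withDensity_of_threshold γ
    (t := ENNReal.ofReal (Real.exp ((a * (σ * r) - (∑ i, δ i ^ 2) / 2) / v))) hS hE
    (fun x hx => ?_) (fun x hx => ?_) ?_
  · have := (hmem x).1 hx
    gcongr
  · have := (not_le.1 (mt (hmem x).2 hx)).le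
    gcongr
  · rwa [hSdef, ← Measure.map_apply hmeas measurableSet_Iic, hlaw]

/-- The Gaussian-smoothing component of the paper's Theorem 3: the classifier smoothed
with isotropic Gaussian noise `N(0, σ²I)` on `ℝ^d` is certifiably robust to any `ℓ₂`
perturbation of magnitude less than `(σ/2)(Φ⁻¹(p_A) − Φ⁻¹(p_B))`, where `Φ` is the
standard Gaussian CDF. -/
theorem gaussian_certified_robustness
    {Y : Type*} (d : ℕ) (hd : 0 < d) (σ : ℝ) (hσ : 0 < σ)
    (h : (Fin d → ℝ) → Y) (hmeas : ∀ y : Y, MeasurableSet {x | h x = y})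
    (w : Fin d → ℝ) (yA : Y) (pA pB : ℝ)
    (hpA0 : 0 < pA) (hpA1 : pA < 1) (hpB0 : 0 < pB) (hpB1 : pB < 1) (hBA : pB ≤ pA)
    (a b : ℝ)
    (hΦa : ((gaussianReal 0 1) (Set.Iic a)).toReal = pA)
    (hΦb : ((gaussianReal 0 1) (Set.Iic b)).toReal = pB)
    (hA : ENNReal.ofReal pA ≤
      Measure.pi (fun _ : Fin d => gaussianReal 0 ⟨σ ^ 2, sq_nonneg σ⟩)
        {e | h (w + e) = yA})
    (hB : ∀ y : Y, y ≠ yA →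
      Measure.pi (fun _ : Fin d => gaussianReal 0 ⟨σ ^ 2, sq_nonneg σ⟩)
          {e | h (w + e) = y} ≤ ENNReal.ofReal pB)
    (δ : Fin d → ℝ) (hδ : Real.sqrt (∑ i, δ i ^ 2) < (σ / 2) * (a - b))
    (y : Y) (hy : y ≠ yA) :
    Measure.pi (fun _ : Fin d => gaussianReal 0 ⟨σ ^ 2, sq_nonneg σ⟩)
        {e | h (w + δ + e) = y}
      ≤ Measure.pi (fun _ : Fin d => gaussianReal 0 ⟨σ ^ 2, sq_nonneg σ⟩)
        {e | h (w + δ + e) = yA} := by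
  set γ := Measure.pi fun _ : Fin d => gaussianReal 0 ⟨σ ^ 2, sq_nonneg σ⟩ with hγ
  have hprob (v : ℝ≥0) : IsProbabilityMeasure (Measure.pi fun _ : Fin d => gaussianReal 0 v) :=
    inferInstance
  have : IsProbabilityMeasure γ := hprob _
  set r := Real.sqrt (∑ i, δ i ^ 2)
  have hE (z : Y) : MeasurableSet {e | h (w + e) = z} := measurable_const_add w (hmeas z)
  have hpre (z : Y) : {e | h (w + δ + e) = z} = (δ + ·) ⁻¹' {e | h (w + e) = z} := by
    ext e
    simp [add_assoc]
  have hadd : Measurable (δ + · : (Fin d → ℝ) → Fin d → ℝ) := measurable_const_add δ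
  have hΦ {c p : ℝ} (hc : (gaussianReal 0 1 (Set.Iic c)).toReal = p) :
      gaussianReal 0 1 (Set.Iic c) = ENNReal.ofReal p := by
    rw [← hc, ENNReal.ofReal_toReal (measure_ne_top _ _)]
  have hlower := gaussianReal_Iic_sub_le_pi_preimage_add hσ rfl δ (hE yA) ((hΦ hΦa).trans_le hA)
  have hcompl : gaussianReal 0 1 (Set.Iic (-b)) ≤ γ {e | h (w + e) = y}ᶜ := by
    rw [gaussianReal_Iic_neg, prob_compl_eq_one_sub (hE y), hΦ hΦb]
    exact tsub_le_tsub_left (hB y hy) 1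
  have hupper := gaussianReal_Iic_sub_le_pi_preimage_add hσ rfl δ (hE y).compl hcompl
  rw [← neg_add', gaussianReal_Iic_neg, Set.preimage_compl, ← hγ,
    prob_compl_eq_one_sub (hadd (hE y))] at hupper
  have hupper' : γ ((δ + ·) ⁻¹' {e | h (w + e) = y}) ≤ gaussianReal 0 1 (Set.Iic (b + r / σ)) :=
    (ENNReal.sub_le_sub_iff_left prob_le_one ENNReal.one_ne_top).1 hupper
  have hab : b + r / σ ≤ a - r / σ := by
    have : r / σ < (a - b) / 2 := by
      rw [div_lt_iff₀ hσ]
      linarith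
    linarith
  rw [hpre, hpre]
  exact hupper'.trans ((measure_mono (Set.Iic_subset_Iic.2 hab)).trans hlower)
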